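/- Let ν ∈ P(E). Then: (a) the condition 'for every n ≥ 0, νK_{ν,∂}^n = (νK_{ν,∂}^n(E))·ν as measures on E' holds if and only if νK_{ν,∂} = (νK_{ν,∂}(E))·ν; (b) if these conditions hold, then νK_{ν,∂}^n(E) = (νK_{ν,∂}(E))^n for every n ≥ 0; (c) if moreover (H0) holds, then these conditions are equivalent to ν = Π_ν. -/

import Mathlib

open MeasureTheory Filter Topology
open scoped ENNReal NNReal

noncomputable section

namespace QSD

variable {E : Type*}

/-- `n`-fold iterate of a sub-Markov kernel given as a measure-valued map:
`kIter K 0 x = δ_x` and `kIter K (n+1) x = (K x).bind (kIter K n)`. -/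
def kIter [MeasurableSpace E] (K : E → Measure E) : ℕ → E → Measure E
  | 0, x => Measure.dirac x
  | n + 1, x => (K x).bind (kIter K n)

/-- Total variation distance between two measures: supremum over measurable sets
of the absolute difference of the masses. -/
def tvDist [MeasurableSpace E] (μ ν : Measure E) : ℝ :=
  ⨆ A : {s : Set E // MeasurableSet s}, |(μ (A : Set E)).toReal - (ν (A : Set E)).toReal|

/-- The kernel `A_μ(x,·) = Σ_{n≥0} K_{μ,∂}^n(x,·)`. -/
def Aker [MeasurableSpace E] (K : E → Measure E) (x : E) : Measure E :=
  Measure.sum fun n => kIter K n x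

/-- `Π_μ = μ A_μ / (μ A_μ)(E)`. -/
def Pim [MeasurableSpace E] (K : E → Measure E) (μ : Measure E) : Measure E :=
  ((μ.bind (Aker K)) Set.univ)⁻¹ • μ.bind (Aker K)

/-- The kernel with redistribution (rebirth) `𝕂_μ(x,·) = K_{μ,∂}(x,·) + δ_μ(x)·μ(·)`,
where `δ_μ(x) = 1 - K_{μ,∂}(x,E)`. -/
def Kret [MeasurableSpace E] (K : E → Measure E) (μ : Measure E) (x : E) : Measure E :=
  K x + (1 - K x Set.univ) • μ

/-- Iterated application of a family of kernels to the constant function `𝟙`: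
`chainV K [μ₁,…,μ_k] x = (K_{μ₁}(K_{μ₂}(⋯(K_{μ_k} 𝟙)⋯)))(x)`. -/
def chainV {V : Type*} [MeasurableSpace V] {I : Type*} (K : I → V → Measure V) :
    List I → V → ℝ≥0∞
  | [], _ => 1
  | μ :: L, x => ∫⁻ y, chainV K L y ∂(K μ x)

end QSD

namespace QSD

section Iterates

variable {E : Type*} [MeasurableSpace E] {K : E → Measure E}

theorem measurable_kIter (hK : Measurable K) (n : ℕ) : Measurable (kIter K n) := by
  induction n with
  | zero => exact Measure.measurable_dirac
  | succ n ih => exact (Measure.measurable_bind' ih).comp hK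

theorem measurable_Aker (hK : Measurable K) : Measurable (Aker K) := by
  refine Measure.measurable_of_measurable_coe _ fun s hs => ?_
  simp only [Aker, Measure.sum_apply _ hs]
  exact Measurable.tsum fun n =>
    (Measure.measurable_coe hs).comp (measurable_kIter hK n)

theorem bind_kIter_zero (m : Measure E) : m.bind (kIter K 0) = m :=
  Measure.bind_dirac

theorem bind_kIter_succ (hK : Measurable K) (m : Measure E) (n : ℕ) :
    m.bind (kIter K (n + 1)) = (m.bind K).bind (kIter K n) :=
  (Measure.bind_bind hK.aemeasurable (measurable_kIter hK n).aemeasurable).symm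

theorem bind_kIter_one (hK : Measurable K) (m : Measure E) : m.bind (kIter K 1) = m.bind K := by
  rw [bind_kIter_succ hK, bind_kIter_zero]

theorem bind_kIter_succ' (hK : Measurable K) (m : Measure E) (n : ℕ) :
    m.bind (kIter K (n + 1)) = (m.bind (kIter K n)).bind K := by
  induction n generalizing m with
  | zero => rw [bind_kIter_one hK, bind_kIter_zero]
  | succ n ih => rw [bind_kIter_succ hK, ih, ← bind_kIter_succ hK]

theorem bind_kIter_of_bind_eq_smul (hK : Measurable K) {m : Measure E} {c : ℝ≥0∞}
    (h : m.bind K = c • m) (n : ℕ) : m.bind (kIter K n) = c ^ n • m := by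
  induction n with
  | zero => rw [bind_kIter_zero, pow_zero, one_smul]
  | succ n ih => rw [bind_kIter_succ hK, h, Measure.bind_smul, ih, smul_smul, pow_succ']

theorem bind_Aker (hK : Measurable K) (m : Measure E) :
    m.bind (Aker K) = Measure.sum fun n => m.bind (kIter K n) := by
  ext s hs
  rw [Measure.bind_apply hs (measurable_Aker hK).aemeasurable, Measure.sum_apply _ hs]
  simp only [Aker, Measure.sum_apply _ hs]
  have hmeas (n : ℕ) : AEMeasurable (fun x => kIter K n x s) m :=
    ((Measure.measurable_coe hs).comp (measurable_kIter hK n)).aemeasurable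
  rw [lintegral_tsum hmeas]
  exact tsum_congr fun n =>
    (Measure.bind_apply hs (measurable_kIter hK n).aemeasurable).symm

theorem bind_Aker_eq_add (hK : Measurable K) (m : Measure E) :
    m.bind (Aker K) = m + (m.bind (Aker K)).bind K := by
  rw [bind_Aker hK, Measure.bind_sum _ _ hK.aemeasurable]
  ext s hs
  rw [Measure.add_apply, Measure.sum_apply _ hs, Measure.sum_apply _ hs,
    tsum_eq_zero_add' ENNReal.summable, bind_kIter_zero]
  simp only [bind_kIter_succ' hK]

theorem bind_Aker_of_bind_eq_smul (hK : Measurable K) {m : Measure E} {c : ℝ≥0∞}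
    (h : m.bind K = c • m) : m.bind (Aker K) = (1 - c)⁻¹ • m := by
  rw [bind_Aker hK]
  ext s hs
  rw [Measure.sum_apply _ hs]
  simp only [bind_kIter_of_bind_eq_smul hK h, Measure.smul_apply, smul_eq_mul]
  rw [ENNReal.tsum_mul_right, ENNReal.tsum_geometric]

variable {ν : Measure E} [IsProbabilityMeasure ν]

theorem eq_univ_smul_of_eq_smul {m : Measure E} {c : ℝ≥0∞} (h : m = c • ν) :
    m = m Set.univ • ν := by
  have hc : m Set.univ = c := by simp [h]
  rw [hc, h]

theorem eq_Pim_of_bind_eq_smul (hK : Measurable K) {c : ℝ≥0∞} (hc : c < 1)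
    (h : ν.bind K = c • ν) : ν = Pim K ν := by
  have hpos : 1 - c ≠ 0 := (tsub_pos_of_lt hc).ne'
  have htop : 1 - c ≠ ∞ := ENNReal.sub_ne_top ENNReal.one_ne_top
  rw [Pim, bind_Aker_of_bind_eq_smul hK h, Measure.smul_apply, measure_univ, smul_eq_mul, mul_one,
    inv_inv, smul_smul, ENNReal.mul_inv_cancel hpos htop, one_smul]

theorem bind_eq_smul_of_eq_Pim (hK : Measurable K) (h : ν = Pim K ν) :
    ∃ c : ℝ≥0∞, ν.bind K = c • ν := by
  set M := ν.bind (Aker K) with hM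
  have hadd : M = ν + M.bind K := bind_Aker_eq_add hK ν
  have hν : ν = (M Set.univ)⁻¹ • M := h
  have htop : M Set.univ ≠ ∞ := by
    intro hinf
    apply IsProbabilityMeasure.ne_zero ν
    rw [hν, hinf, ENNReal.inv_top, zero_smul]
  have hpos : M Set.univ ≠ 0 := by
    rw [hadd, Measure.add_apply, measure_univ]
    simp
  have hMν : M = M Set.univ • ν := by
    conv_rhs => rw [hν]
    rw [smul_smul, ENNReal.mul_inv_cancel hpos htop, one_smul]
  have hMK : M.bind K = (M Set.univ - 1) • ν := by
    ext s hs
    have hs' : M s = ν s + M.bind K s := by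
      conv_lhs => rw [hadd]
      rfl
    have hs'' : M s = M Set.univ * ν s := by
      conv_lhs => rw [hMν]
      rfl
    rw [Measure.smul_apply, smul_eq_mul, ENNReal.sub_mul fun _ _ => measure_ne_top ν s, one_mul,
      ← hs'', hs', ENNReal.add_sub_cancel_left (measure_ne_top ν s)]
  refine ⟨(M Set.univ)⁻¹ * (M Set.univ - 1), ?_⟩
  rw [mul_smul, ← hMK, ← Measure.bind_smul, ← hν]

theorem lt_one_of_bind_eq_smul (hK : Measurable K) {c ρ : ℝ≥0∞} {ℓ : ℕ} (hρ : ρ < 1)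
    (hbound : ∀ x, kIter K ℓ x Set.univ ≤ ρ) (h : ν.bind K = c • ν) : c < 1 := by
  by_contra! hc
  have hmass : c ^ ℓ ≤ ρ := by
    calc c ^ ℓ = ν.bind (kIter K ℓ) Set.univ := by
          simp [bind_kIter_of_bind_eq_smul hK h]
      _ = ∫⁻ x, kIter K ℓ x Set.univ ∂ν :=
          Measure.bind_apply MeasurableSet.univ (measurable_kIter hK ℓ).aemeasurable
      _ ≤ ∫⁻ _, ρ ∂ν := lintegral_mono hbound
      _ = ρ := by simp
  exact absurd (hmass.trans_lt hρ) (one_le_pow₀ hc).not_gt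

end Iterates

end QSD

open QSD

/-- characterization of QSDs, Lemma 3.1 (iii): for `ν ∈ P(E)`,
(a) the QSD property `νK_{ν,∂}^n = (νK_{ν,∂}^n(E))·ν` for all `n` is equivalent to the
one-step identity `νK_{ν,∂} = (νK_{ν,∂}(E))·ν`; (b) in that case
`νK_{ν,∂}^n(E) = (νK_{ν,∂}(E))^n`; and (c) under (H0) these are equivalent to `ν = Π_ν`. -/
theorem stmt3
    {E : Type*} [MeasurableSpace E]
    (K : ProbabilityMeasure E → E → Measure E)
    (hKmeas : ∀ μ, Measurable (K μ))
    (hKsub : ∀ μ x, K μ x Set.univ ≤ 1)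
    (ν : ProbabilityMeasure E) :
    -- (a)
    ((∀ n : ℕ, (ν : Measure E).bind (kIter (K ν) n)
        = (((ν : Measure E).bind (kIter (K ν) n)) Set.univ) • (ν : Measure E)) ↔
      (ν : Measure E).bind (K ν)
        = (((ν : Measure E).bind (K ν)) Set.univ) • (ν : Measure E)) ∧
    -- (b)
    ((ν : Measure E).bind (K ν)
        = (((ν : Measure E).bind (K ν)) Set.univ) • (ν : Measure E) →
      ∀ n : ℕ, ((ν : Measure E).bind (kIter (K ν) n)) Set.univ
        = (((ν : Measure E).bind (K ν)) Set.univ) ^ n) ∧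
    -- (c)
    (∀ ℓ : ℕ, 1 ≤ ℓ → ∀ ρ : ℝ≥0∞, ρ < 1 →
      (∀ (μ : ProbabilityMeasure E) (x : E), kIter (K μ) ℓ x Set.univ ≤ ρ) →
      ((ν : Measure E).bind (K ν)
          = (((ν : Measure E).bind (K ν)) Set.univ) • (ν : Measure E) ↔
        (ν : Measure E) = Pim (K ν) (ν : Measure E))) := by
  have hK := hKmeas ν
  refine ⟨⟨fun h => ?_, fun h n => ?_⟩, fun h n => ?_,
    fun ℓ _ ρ hρ hbound => ⟨fun h => ?_, fun h => ?_⟩⟩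
  · simpa only [bind_kIter_one hK] using h 1
  · exact eq_univ_smul_of_eq_smul (bind_kIter_of_bind_eq_smul hK h n)
  · rw [bind_kIter_of_bind_eq_smul hK h n, Measure.smul_apply,
      measure_univ (μ := (ν : Measure E)), smul_eq_mul, mul_one]
  · exact eq_Pim_of_bind_eq_smul hK (lt_one_of_bind_eq_smul hK hρ (hbound ν) h) h
  · obtain ⟨c, hc⟩ := bind_eq_smul_of_eq_Pim hK h
    exact eq_univ_smul_of_eq_smul hc
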